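/- Let m ∈ ℕ, let J^+ and J^− be disjoint finite index sets with |J^+| + |J^−| = 2m, and for each j ∈ J^+ ∪ J^− let c_j : [0,1] → ℝ be continuous and strictly positive. Let B be an arbitrary real 2m×2m matrix, and on X_1 := (L^1(0,1))^{2m} define the operator A_B by (A_B(v,w))_j = −c_j v_j′ for j ∈ J^+ and (A_B(v,w))_j = c_j w_j′ for j ∈ J^−, with domain D_1(A_B) := {(v,w) ∈ (W^{1,1}(0,1))^{2m} : (v(0), w(1))^T = B (v(1), w(0))^T}. Then (A_B, D_1(A_B)) generates a strongly continuous semigroup on X_1. -/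

import Mathlib

open MeasureTheory Set Filter
open scoped NNReal ENNReal

/-- Lebesgue measure on the interval `(0,1)`. -/
noncomputable def mu01 : Measure ℝ := volume.restrict (Set.Ioo 0 1)

/-- `g` is a `W^{1,1}(0,1)` function with (weak) derivative `g'`:
both are integrable on `(0,1)` and `g` is the integral of `g'`. -/
def IsW11Rep (g g' : ℝ → ℝ) : Prop :=
  IntegrableOn g (Set.Ioo 0 1) ∧ IntegrableOn g' (Set.Ioo 0 1) ∧
    ∀ x ∈ Set.Icc (0:ℝ) 1, g x = g 0 + ∫ t in (0:ℝ)..x, g' t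

/-- The graph of the operator `(A_B, D_1(A_B))`: `ABGraph c B u Au` holds iff
`u ∈ D_1(A_B)` and `A_B u = Au`.  Here the first (`Sum.inl`, i.e. `J⁺`) components flow
from `0` to `1` with speeds `c` and the second (`Sum.inr`, i.e. `J⁻`) components flow from
`1` to `0`; the domain consists of `(W^{1,1}(0,1))^{2m}` functions whose outgoing boundary
values `(v(0), w(1))` are given by `B` applied to the incoming ones `(v(1), w(0))`. -/
def ABGraph {Jp Jm : Type*} [Fintype Jp] [Fintype Jm]
    (c : Jp ⊕ Jm → ℝ → ℝ) (B : Matrix (Jp ⊕ Jm) (Jp ⊕ Jm) ℝ)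
    (u Au : (Jp ⊕ Jm) → Lp ℝ 1 mu01) : Prop :=
  ∃ g g' : (Jp ⊕ Jm) → ℝ → ℝ,
    (∀ j, IsW11Rep (g j) (g' j)) ∧
    (∀ j, (u j : ℝ → ℝ) =ᵐ[mu01] g j) ∧
    (∀ j : Jp, (Au (Sum.inl j) : ℝ → ℝ) =ᵐ[mu01]
      fun x => -(c (Sum.inl j) x * g' (Sum.inl j) x)) ∧
    (∀ j : Jm, (Au (Sum.inr j) : ℝ → ℝ) =ᵐ[mu01]
      fun x => c (Sum.inr j) x * g' (Sum.inr j) x) ∧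
    (Sum.elim (fun j : Jp => g (Sum.inl j) 0) (fun j : Jm => g (Sum.inr j) 1) =
      B.mulVec (Sum.elim (fun j : Jp => g (Sum.inl j) 1) (fun j : Jm => g (Sum.inr j) 0)))


namespace HyperbolicNetwork

section WeightedComposition

variable {α β : Type*} [MeasurableSpace α] [MeasurableSpace β] {μ : Measure α} {ν : Measure β}

/-- The weighted composition `f ↦ w · (f ∘ φ)` is bounded from `L¹(μ)` to `L¹(ν)` by `C`. -/
structure WCompBound (μ : Measure α) (ν : Measure β) (φ : β → α) (w : β → ℝ) (C : ℝ≥0) :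
    Prop where
  measurable_map : Measurable φ
  measurable_weight : Measurable w
  lintegral_le : ∀ f : α → ℝ≥0∞, Measurable f → ∫⁻ x, ‖w x‖ₑ * f (φ x) ∂ν ≤ C * ∫⁻ x, f x ∂μ

variable {φ : β → α} {w : β → ℝ} {C : ℝ≥0}

theorem WCompBound.ae_of_ae (h : WCompBound μ ν φ w C) {p : α → Prop} (hp : ∀ᵐ x ∂μ, p x) :
    ∀ᵐ x ∂ν, w x ≠ 0 → p (φ x) := by
  set N := toMeasurable μ {x | ¬ p x}
  have hN : MeasurableSet N := measurableSet_toMeasurable _ _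
  have hN0 : μ N = 0 := by rw [measure_toMeasurable]; exact hp
  have h1 := h.lintegral_le (N.indicator 1) (measurable_one.indicator hN)
  rw [lintegral_indicator_one hN, hN0, mul_zero, nonpos_iff_eq_zero, lintegral_eq_zero_iff] at h1
  · filter_upwards [h1] with x hx hw
    by_contra hpx
    have : φ x ∈ N := subset_toMeasurable _ _ hpx
    simp [this, hw] at hx
  · exact h.measurable_weight.enorm.mul ((measurable_one.indicator hN).comp h.measurable_map)

theorem WCompBound.congr (h : WCompBound μ ν φ w C) {f g : α → ℝ} (hfg : f =ᵐ[μ] g) :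
    (fun x => w x * f (φ x)) =ᵐ[ν] fun x => w x * g (φ x) := by
  filter_upwards [h.ae_of_ae hfg] with x hx
  by_cases hw : w x = 0
  · simp [hw]
  · rw [hx hw]

theorem WCompBound.lintegral_enorm_le (h : WCompBound μ ν φ w C) (f : Lp ℝ 1 μ) :
    ∫⁻ x, ‖w x * f (φ x)‖ₑ ∂ν ≤ C * ∫⁻ x, ‖f x‖ₑ ∂μ := by
  simp_rw [enorm_mul]
  exact h.lintegral_le (fun x => ‖f x‖ₑ) (Lp.stronglyMeasurable f).measurable.enorm

theorem WCompBound.memLp (h : WCompBound μ ν φ w C) (f : Lp ℝ 1 μ) :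
    MemLp (fun x => w x * f (φ x)) 1 ν := by
  refine ⟨(h.measurable_weight.mul
    ((Lp.stronglyMeasurable f).measurable.comp h.measurable_map)).aestronglyMeasurable, ?_⟩
  rw [eLpNorm_one_eq_lintegral_enorm]
  refine (h.lintegral_enorm_le f).trans_lt (ENNReal.mul_lt_top ENNReal.coe_lt_top ?_)
  rw [← eLpNorm_one_eq_lintegral_enorm]
  exact Lp.eLpNorm_lt_top f

/-- The bounded operator `f ↦ w · (f ∘ φ)` on `L¹`. -/
noncomputable def wcomp (h : WCompBound μ ν φ w C) : Lp ℝ 1 μ →L[ℝ] Lp ℝ 1 ν :=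
  LinearMap.mkContinuous
    { toFun := fun f => (h.memLp f).toLp _
      map_add' := fun f g => by
        rw [← MemLp.toLp_add, MemLp.toLp_eq_toLp_iff]
        filter_upwards [h.congr (Lp.coeFn_add f g)] with x hx
        rw [hx]
        simp [mul_add]
      map_smul' := fun a f => by
        rw [RingHom.id_apply, ← MemLp.toLp_const_smul, MemLp.toLp_eq_toLp_iff]
        filter_upwards [h.congr (Lp.coeFn_smul a f)] with x hx
        rw [hx]
        simp [mul_left_comm] }
    C fun f => by
      rw [LinearMap.coe_mk, AddHom.coe_mk, Lp.norm_toLp, Lp.norm_def,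
        eLpNorm_one_eq_lintegral_enorm, eLpNorm_one_eq_lintegral_enorm,
        ← ENNReal.coe_toReal C, ← ENNReal.toReal_mul]
      refine ENNReal.toReal_mono (ENNReal.mul_ne_top ENNReal.coe_ne_top ?_)
        (h.lintegral_enorm_le f)
      rw [← eLpNorm_one_eq_lintegral_enorm]
      exact (Lp.eLpNorm_lt_top f).ne

theorem coeFn_wcomp (h : WCompBound μ ν φ w C) (f : Lp ℝ 1 μ) :
    wcomp h f =ᵐ[ν] fun x => w x * f (φ x) :=
  (h.memLp f).coeFn_toLp

end WeightedComposition

/-- Multiplication by the indicator function of a measurable set, on `L¹(ℝ)`. -/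
noncomputable def cutoff (s : Set ℝ) (hs : MeasurableSet s) :
    Lp ℝ 1 (volume : Measure ℝ) →L[ℝ] Lp ℝ 1 (volume : Measure ℝ) :=
  wcomp (φ := id) (w := s.indicator 1) (C := 1)
    { measurable_map := measurable_id
      measurable_weight := measurable_one.indicator hs
      lintegral_le := fun f _ => by
        rw [ENNReal.coe_one, one_mul]
        refine lintegral_mono fun x => ?_
        by_cases hx : x ∈ s <;> simp [hx] }

theorem coeFn_cutoff {s : Set ℝ} (hs : MeasurableSet s) (f : Lp ℝ 1 (volume : Measure ℝ)) :
    cutoff s hs f =ᵐ[volume] s.indicator f := by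
  filter_upwards [coeFn_wcomp (φ := id) (w := s.indicator 1) (C := 1) _ f] with x hx
  refine hx.trans ?_
  by_cases hx : x ∈ s <;> simp [hx]

theorem norm_cutoff_le {s : Set ℝ} (hs : MeasurableSet s) (f : Lp ℝ 1 (volume : Measure ℝ)) :
    ‖cutoff s hs f‖ ≤ ‖f‖ := by
  rw [Lp.norm_def, Lp.norm_def]
  refine ENNReal.toReal_mono (Lp.eLpNorm_lt_top f).ne ?_
  rw [eLpNorm_congr_ae (coeFn_cutoff hs f)]
  exact eLpNorm_indicator_le _

/-- Left translation `f ↦ f (· + t)` on `L¹(ℝ)`. -/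
noncomputable def shift (t : ℝ) :
    Lp ℝ 1 (volume : Measure ℝ) →L[ℝ] Lp ℝ 1 (volume : Measure ℝ) :=
  (Lp.compMeasurePreservingₗᵢ ℝ (fun x : ℝ => x + t)
    (measurePreserving_add_right volume t)).toContinuousLinearMap

theorem coeFn_shift (t : ℝ) (f : Lp ℝ 1 (volume : Measure ℝ)) :
    shift t f =ᵐ[volume] fun x => f (x + t) :=
  Lp.coeFn_compMeasurePreserving f (measurePreserving_add_right volume t)

theorem norm_shift (t : ℝ) (f : Lp ℝ 1 (volume : Measure ℝ)) : ‖shift t f‖ = ‖f‖ :=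
  LinearIsometry.norm_map _ f

theorem ae_shift {p : ℝ → Prop} (hp : ∀ᵐ x, p x) (t : ℝ) : ∀ᵐ x, p (x + t) :=
  (measurePreserving_add_right volume t).quasiMeasurePreserving.ae hp

theorem shift_shift (s t : ℝ) (f : Lp ℝ 1 (volume : Measure ℝ)) :
    shift s (shift t f) = shift (s + t) f := by
  refine Lp.ext ?_
  filter_upwards [coeFn_shift s (shift t f), coeFn_shift (s + t) f,
    ae_shift (coeFn_shift t f) s] with x h1 h2 h3
  rw [h1, h2, h3, add_assoc]

theorem shift_zero (f : Lp ℝ 1 (volume : Measure ℝ)) : shift 0 f = f := by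
  refine Lp.ext ?_
  filter_upwards [coeFn_shift 0 f] with x h1
  rw [h1, add_zero]

theorem continuous_shift (f : Lp ℝ 1 (volume : Measure ℝ)) : Continuous fun t => shift t f := by
  have hg (t : ℝ) : MeasurePreserving (ContinuousMap.curry (⟨fun a : ℝ × ℝ => a.2 + a.1,
      by fun_prop⟩ : C(ℝ × ℝ, ℝ)) t) volume volume := measurePreserving_add_right volume t
  exact Continuous.compMeasurePreservingLp (continuous_const (y := f))
    (ContinuousMap.continuous _) hg ENNReal.one_ne_top

theorem norm_le_of_ae_average {F D : Lp ℝ 1 (volume : Measure ℝ)} {t η : ℝ} (ht : 0 < t)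
    (hη : 0 ≤ η) (hF : ∀ s ∈ Ioo 0 t, ‖shift s F - F‖ ≤ η)
    (hD : ∀ᵐ x, D x = 0 ∨ D x = t⁻¹ * (∫ y in x..x + t, F y) - F x) : ‖D‖ ≤ η := by
  have hFm : Measurable F := (Lp.stronglyMeasurable F).measurable
  have hFi (a b : ℝ) : IntervalIntegrable F volume a b :=
    (L1.integrable_coeFn F).intervalIntegrable
  have hpt (x : ℝ) : ‖t⁻¹ * (∫ y in x..x + t, F y) - F x‖ₑ ≤
      ENNReal.ofReal t⁻¹ * ∫⁻ s in Ioo 0 t, ‖F (x + s) - F x‖ₑ := by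
    have h1 : t⁻¹ * (∫ y in x..x + t, F y) - F x = t⁻¹ * ∫ s in Ioo 0 t, (F (x + s) - F x) := by
      rw [← integral_Ioc_eq_integral_Ioo, ← intervalIntegral.integral_of_le ht.le,
        intervalIntegral.integral_sub _ intervalIntegrable_const,
        intervalIntegral.integral_comp_add_left (fun y => F y), intervalIntegral.integral_const]
      · rw [add_zero, sub_zero, smul_eq_mul]
        field_simp
      · simpa using (hFi (x + 0) (x + t)).comp_add_left x
    rw [h1, enorm_mul, Real.enorm_of_nonneg (inv_pos.2 ht).le]
    gcongr
    exact enorm_integral_le_lintegral_enorm _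
  have hsh (s : ℝ) (hs : s ∈ Ioo 0 t) : ∫⁻ x, ‖F (x + s) - F x‖ₑ ≤ ENNReal.ofReal η := by
    have h1 : ∫⁻ x, ‖F (x + s) - F x‖ₑ = ‖shift s F - F‖ₑ := by
      rw [Lp.enorm_def, eLpNorm_one_eq_lintegral_enorm]
      refine lintegral_congr_ae ?_
      filter_upwards [Lp.coeFn_sub (shift s F) F, coeFn_shift s F] with x h1 h2
      rw [h1, Pi.sub_apply, h2]
    rw [h1, ← ofReal_norm]
    exact ENNReal.ofReal_le_ofReal (hF s hs)
  have key : ‖D‖ₑ ≤ ENNReal.ofReal η := by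
    rw [Lp.enorm_def, eLpNorm_one_eq_lintegral_enorm]
    calc ∫⁻ x, ‖D x‖ₑ ≤ ∫⁻ x, ENNReal.ofReal t⁻¹ * ∫⁻ s in Ioo 0 t, ‖F (x + s) - F x‖ₑ := by
          refine lintegral_mono_ae ?_
          filter_upwards [hD] with x hx
          rcases hx with hx | hx
          · simp [hx]
          · rw [hx]; exact hpt x
      _ = ENNReal.ofReal t⁻¹ * ∫⁻ s in Ioo 0 t, ∫⁻ x, ‖F (x + s) - F x‖ₑ := by
          rw [lintegral_const_mul' _ _ ENNReal.ofReal_ne_top, lintegral_lintegral_swap]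
          refine Measurable.aemeasurable ?_
          simp only [Function.uncurry_def]
          fun_prop
      _ ≤ ENNReal.ofReal t⁻¹ * ∫⁻ s in Ioo 0 t, ENNReal.ofReal η := by
          gcongr 1
          exact setLIntegral_mono measurable_const hsh
      _ = ENNReal.ofReal η := by
          rw [setLIntegral_const, Real.volume_Ioo, sub_zero, mul_comm (ENNReal.ofReal η),
            ← mul_assoc, ← ENNReal.ofReal_mul (inv_pos.2 ht).le, inv_mul_cancel₀ ht.ne',
            ENNReal.ofReal_one, one_mul]
  rw [← ofReal_norm] at key
  exact (ENNReal.ofReal_le_ofReal_iff hη).1 key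

theorem tendsto_cutoff_shift_atTop (a b : ℝ) (g : Lp ℝ 1 (volume : Measure ℝ)) :
    Tendsto (fun t => ‖cutoff (Ioo a b) measurableSet_Ioo (shift t g)‖) atTop (nhds 0) := by
  have hgm : Measurable g := (Lp.stronglyMeasurable g).measurable
  have hfin : ∫⁻ x, ‖g x‖ₑ ≠ ⊤ := by
    rw [← eLpNorm_one_eq_lintegral_enorm]
    exact (Lp.eLpNorm_lt_top g).ne
  have h1 (t : ℝ) : ‖cutoff (Ioo a b) measurableSet_Ioo (shift t g)‖ =
      (∫⁻ x, (Iio (b + t) ∩ Ioi (a + t)).indicator (fun x => ‖g x‖ₑ) x).toReal := by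
    rw [Lp.norm_def, eLpNorm_one_eq_lintegral_enorm,
      ← lintegral_add_right_eq_self (μ := volume)
        ((Iio (b + t) ∩ Ioi (a + t)).indicator fun x => ‖g x‖ₑ) t]
    congr 1
    refine lintegral_congr_ae ?_
    filter_upwards [coeFn_cutoff measurableSet_Ioo (shift t g), coeFn_shift t g] with x h1 h2
    rw [h1]
    by_cases hx : x ∈ Ioo a b
    · simp [h2, hx.1, hx.2]
    · rw [indicator_of_notMem hx, indicator_of_notMem]
      · simp
      · simpa [and_comm] using hx
  simp_rw [h1]
  rw [← ENNReal.toReal_zero]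
  refine (ENNReal.tendsto_toReal ENNReal.zero_ne_top).comp ?_
  rw [← lintegral_zero (μ := (volume : Measure ℝ)) (α := ℝ)]
  refine tendsto_lintegral_filter_of_dominated_convergence (fun x => ‖g x‖ₑ)
    (Eventually.of_forall fun t => ?_) (Eventually.of_forall fun t => ae_of_all _ fun x => ?_) hfin
    (ae_of_all _ fun x => ?_)
  · exact hgm.enorm.indicator (measurableSet_Iio.inter measurableSet_Ioi)
  · exact indicator_le_self _ _ x
  · refine tendsto_const_nhds.congr' ?_
    filter_upwards [eventually_gt_atTop (x - a)] with t ht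
    rw [indicator_of_notMem]
    simp only [mem_inter_iff, mem_Ioi, not_and, not_lt]
    intro _
    linarith

/-- Data of a linear delay system: component `j` has a history of length `τ j`, embedded by `i j`
into `L¹(ℝ)` as the functions supported on `(-τ j, 0)`, and the boundary values are prescribed by
the matrix `b`, which is a strict contraction for the maximum norm. -/
structure DelaySystem (J E : Type*) [Fintype J] [NormedAddCommGroup E] [NormedSpace ℝ E] where
  τ : J → ℝ
  τ_pos : ∀ j, 0 < τ j
  b : Matrix J J ℝ
  q : ℝ
  q_nonneg : 0 ≤ q
  q_lt_one : q < 1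
  sum_abs_le : ∀ j, ∑ k, |b j k| ≤ q
  i : J → E →L[ℝ] Lp ℝ 1 (volume : Measure ℝ)
  r : J → Lp ℝ 1 (volume : Measure ℝ) →L[ℝ] E
  r_i : ∀ j x, r j (i j x) = x
  i_r : ∀ j g, i j (r j g) = cutoff (Ioo (-τ j) 0) measurableSet_Ioo g

namespace DelaySystem

variable {J E : Type*} [Fintype J] [NormedAddCommGroup E] [NormedSpace ℝ E]
  (D : DelaySystem J E)

/-- The boundary feedback on `[0, ∞)`. -/
noncomputable def feedback : (J → Lp ℝ 1 (volume : Measure ℝ)) →L[ℝ]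
    (J → Lp ℝ 1 (volume : Measure ℝ)) :=
  ContinuousLinearMap.pi fun j => (cutoff (Ici 0) measurableSet_Ici).comp
    (∑ k, D.b j k • (shift (-D.τ k)).comp (ContinuousLinearMap.proj k))

theorem feedback_apply (g : J → Lp ℝ 1 (volume : Measure ℝ)) (j : J) :
    D.feedback g j = cutoff (Ici 0) measurableSet_Ici (∑ k, D.b j k • shift (-D.τ k) (g k)) := by
  simp [feedback]

theorem norm_feedback_le : ‖D.feedback‖ ≤ D.q := by
  refine ContinuousLinearMap.opNorm_le_bound _ D.q_nonneg fun g => ?_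
  refine (pi_norm_le_iff_of_nonneg (mul_nonneg D.q_nonneg (norm_nonneg _))).2 fun j => ?_
  rw [feedback_apply]
  refine (norm_cutoff_le _ _).trans ((norm_sum_le _ _).trans ?_)
  calc ∑ k, ‖D.b j k • shift (-D.τ k) (g k)‖ ≤ ∑ k, |D.b j k| * ‖g‖ := by
        refine Finset.sum_le_sum fun k _ => ?_
        rw [norm_smul, norm_shift, Real.norm_eq_abs]
        gcongr
        exact norm_le_pi_norm g k
    _ ≤ D.q * ‖g‖ := by
        rw [← Finset.sum_mul]
        gcongr
        exact D.sum_abs_le j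

theorem feedback_ae (g : J → Lp ℝ 1 (volume : Measure ℝ)) (j : J) :
    ∀ᵐ x, D.feedback g j x =
      (Ici 0).indicator (fun x => ∑ k, D.b j k * g k (x - D.τ k)) x := by
  have h : ∀ᵐ x, (∑ k, D.b j k • shift (-D.τ k) (g k) : Lp ℝ 1 (volume : Measure ℝ)) x =
      ∑ k, D.b j k * g k (x - D.τ k) := by
    filter_upwards [Lp.coeFn_finsetSum Finset.univ fun k => D.b j k • shift (-D.τ k) (g k),
      ae_all_iff.2 fun k => Lp.coeFn_smul (D.b j k) (shift (-D.τ k) (g k)),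
      ae_all_iff.2 fun k => coeFn_shift (-D.τ k) (g k)] with x h1 h2 h3
    rw [h1, Finset.sum_apply]
    refine Finset.sum_congr rfl fun k _ => ?_
    rw [h2, Pi.smul_apply, h3, smul_eq_mul, sub_eq_add_neg]
  filter_upwards [h, coeFn_cutoff measurableSet_Ici
    (∑ k, D.b j k • shift (-D.τ k) (g k) : Lp ℝ 1 (volume : Measure ℝ))] with x h1 h2
  rw [feedback_apply, h2]
  by_cases hx : x ∈ Ici (0 : ℝ)
  · rw [indicator_of_mem hx, indicator_of_mem hx, h1]
  · rw [indicator_of_notMem hx, indicator_of_notMem hx]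

/-- The extension of histories to solutions of the delay equation on the whole half-line. -/
noncomputable def ext : (J → E) →L[ℝ] (J → Lp ℝ 1 (volume : Measure ℝ)) :=
  ((↑(Units.oneSub D.feedback (D.norm_feedback_le.trans_lt D.q_lt_one))⁻¹ :
    (J → Lp ℝ 1 (volume : Measure ℝ)) →L[ℝ] (J → Lp ℝ 1 (volume : Measure ℝ)))).comp
    (ContinuousLinearMap.pi fun j => (D.i j).comp (ContinuousLinearMap.proj j))

theorem ext_eq (u : J → E) : D.ext u = D.feedback (D.ext u) + fun j => D.i j (u j) := by
  have h := congrArg (fun A : (J → Lp ℝ 1 (volume : Measure ℝ)) →L[ℝ]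
    (J → Lp ℝ 1 (volume : Measure ℝ)) => A (fun j => D.i j (u j)))
    (Units.mul_inv (Units.oneSub D.feedback (D.norm_feedback_le.trans_lt D.q_lt_one)))
  rw [Units.val_oneSub] at h
  exact sub_eq_iff_eq_add'.1 h

theorem eq_ext {u : J → E} {g : J → Lp ℝ 1 (volume : Measure ℝ)}
    (hg : g = D.feedback g + fun j => D.i j (u j)) : g = D.ext u := by
  have h : g - D.ext u = D.feedback (g - D.ext u) := by
    rw [map_sub]
    nth_rw 1 [hg, D.ext_eq u]
    abel
  have h1 : ‖g - D.ext u‖ ≤ D.q * ‖g - D.ext u‖ := by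
    nth_rw 1 [h]
    exact D.feedback.le_of_opNorm_le D.norm_feedback_le _
  have h2 : ‖g - D.ext u‖ ≤ 0 := by nlinarith [D.q_lt_one, norm_nonneg (g - D.ext u)]
  exact sub_eq_zero.1 (norm_le_zero_iff.1 h2)

theorem i_ae (j : J) (x : E) : ∀ᵐ s, s ∉ Ioo (-D.τ j) 0 → D.i j x s = 0 := by
  have h := D.i_r j (D.i j x)
  rw [D.r_i] at h
  rw [h]
  filter_upwards [coeFn_cutoff measurableSet_Ioo (D.i j x)] with s hs hs'
  rw [hs, indicator_of_notMem hs']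

theorem ext_ae (u : J → E) (j : J) : ∀ᵐ x, D.ext u j x =
    (Ici 0).indicator (fun x => ∑ k, D.b j k * D.ext u k (x - D.τ k)) x + D.i j (u j) x := by
  have h := congrFun (D.ext_eq u) j
  filter_upwards [D.feedback_ae (D.ext u) j,
    Lp.coeFn_add (D.feedback (D.ext u) j) (D.i j (u j))] with x h1 h2
  rw [h, Pi.add_apply, h2, Pi.add_apply, h1]

theorem ext_ae_history (u : J → E) (j : J) :
    ∀ᵐ x, x < 0 → D.ext u j x = D.i j (u j) x := by
  filter_upwards [D.ext_ae u j] with x h1 hx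
  rw [h1, indicator_of_notMem (by simpa using hx), zero_add]

theorem ext_ae_future (u : J → E) (j : J) :
    ∀ᵐ x, 0 < x → D.ext u j x = ∑ k, D.b j k * D.ext u k (x - D.τ k) := by
  filter_upwards [D.ext_ae u j, D.i_ae j (u j)] with x h1 h2 hx
  rw [h1, indicator_of_mem (by simpa using hx.le), h2 (fun h => h.2.not_gt hx), add_zero]

theorem r_cutoff (j : J) (g : Lp ℝ 1 (volume : Measure ℝ)) :
    D.r j (cutoff (Ioo (-D.τ j) 0) measurableSet_Ioo g) = D.r j g := by
  rw [← D.i_r, D.r_i]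

theorem r_congr {j : J} {f g : Lp ℝ 1 (volume : Measure ℝ)}
    (h : ∀ᵐ x, x ∈ Ioo (-D.τ j) 0 → f x = g x) : D.r j f = D.r j g := by
  rw [← D.r_cutoff j f, ← D.r_cutoff j g]
  congr 1
  refine Lp.ext ?_
  filter_upwards [h, coeFn_cutoff measurableSet_Ioo f, coeFn_cutoff measurableSet_Ioo g]
    with x h1 h2 h3
  rw [h2, h3]
  by_cases hx : x ∈ Ioo (-D.τ j) 0
  · rw [indicator_of_mem hx, indicator_of_mem hx, h1 hx]
  · rw [indicator_of_notMem hx, indicator_of_notMem hx]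

theorem r_ext (u : J → E) (j : J) : D.r j (D.ext u j) = u j := by
  rw [← D.r_i j (u j)]
  refine D.r_congr ?_
  filter_upwards [D.ext_ae_history u j] with x h hx
  exact h hx.2

/-- The solution operators of the delay system. -/
noncomputable def flow (t : ℝ) : (J → E) →L[ℝ] (J → E) :=
  (ContinuousLinearMap.pi fun j =>
    ((D.r j).comp (shift t)).comp (ContinuousLinearMap.proj j)).comp D.ext

theorem flow_apply (t : ℝ) (u : J → E) (j : J) : D.flow t u j = D.r j (shift t (D.ext u j)) :=
  rfl

theorem flow_zero (u : J → E) : D.flow 0 u = u := by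
  ext1 j
  rw [flow_apply, shift_zero, r_ext]

theorem continuous_flow (u : J → E) : Continuous fun t => D.flow t u :=
  continuous_pi fun j => (D.r j).continuous.comp (continuous_shift _)

theorem ext_flow {t : ℝ} (ht : 0 ≤ t) (u : J → E) : D.ext (D.flow t u) = fun j =>
    cutoff (Ioi (-D.τ j)) measurableSet_Ioi (shift t (D.ext u j)) := by
  symm
  set f : J → Lp ℝ 1 (volume : Measure ℝ) := fun j =>
    cutoff (Ioi (-D.τ j)) measurableSet_Ioi (shift t (D.ext u j)) with hf
  have hfae (j : J) : ∀ᵐ x, f j x = (Ioi (-D.τ j)).indicator (fun x => D.ext u j (x + t)) x := by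
    filter_upwards [coeFn_cutoff measurableSet_Ioi (shift t (D.ext u j)),
      coeFn_shift t (D.ext u j)] with x h1 h2
    rw [h1]
    by_cases hx : x ∈ Ioi (-D.τ j)
    · rw [indicator_of_mem hx, indicator_of_mem hx, h2]
    · rw [indicator_of_notMem hx, indicator_of_notMem hx]
  refine D.eq_ext ?_
  ext1 j
  refine Lp.ext ?_
  rw [Pi.add_apply, flow_apply, D.i_r]
  filter_upwards [Lp.coeFn_add (D.feedback f j)
      (cutoff (Ioo (-D.τ j) 0) measurableSet_Ioo (shift t (D.ext u j))), D.feedback_ae f j,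
    coeFn_cutoff measurableSet_Ioo (shift t (D.ext u j)), coeFn_shift t (D.ext u j), hfae j,
    ae_shift (D.ext_ae_future u j) t, volume.ae_ne (0 : ℝ),
    ae_all_iff.2 fun k => ae_shift (hfae k) (-D.τ k)] with x h1 h2 h3 h4 h5 h6 h7 h8
  rw [h1, Pi.add_apply, h2, h3, h5]
  rcases lt_or_gt_of_ne h7 with hx | hx
  · rw [indicator_of_notMem (s := Ici 0) (by simpa using hx), zero_add]
    by_cases hx' : x ∈ Ioi (-D.τ j)
    · rw [indicator_of_mem hx', indicator_of_mem (s := Ioo _ _) ⟨hx', hx⟩, h4]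
    · rw [indicator_of_notMem hx', indicator_of_notMem fun h => hx' h.1]
  · rw [indicator_of_mem (s := Ici 0) (by simpa using hx.le),
      indicator_of_notMem (s := Ioo _ _) (fun h => h.2.not_gt hx), add_zero,
      indicator_of_mem (by have := D.τ_pos j; simp; linarith), h6 (by linarith)]
    refine Finset.sum_congr rfl fun k _ => ?_
    rw [sub_eq_add_neg x, h8, indicator_of_mem (by simp; linarith)]
    congr 2
    ring

theorem flow_flow {s t : ℝ} (hs : 0 ≤ s) (ht : 0 ≤ t) (u : J → E) :
    D.flow s (D.flow t u) = D.flow (s + t) u := by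
  ext1 j
  rw [flow_apply, flow_apply, D.ext_flow ht, ← shift_shift]
  refine D.r_congr ?_
  filter_upwards [coeFn_shift s (cutoff (Ioi (-D.τ j)) measurableSet_Ioi (shift t (D.ext u j))),
    coeFn_shift s (shift t (D.ext u j)),
    ae_shift (coeFn_cutoff measurableSet_Ioi (shift t (D.ext u j))) s] with x h1 h2 h3 hx
  rw [h1, h2, h3, indicator_of_mem]
  have := hx.1
  simp only [mem_Ioi]
  linarith

theorem eq_zero_of_tendsto_zero {u : J → E}
    (h : Tendsto (fun t : ℝ => t⁻¹ • (D.flow t u - u)) (nhdsWithin 0 (Ioi 0)) (nhds 0)) :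
    u = 0 := by
  have hconst (t : ℝ) (ht : 0 ≤ t) : D.flow t u = u := by
    have h1 := constant_of_has_deriv_right_zero (a := 0) (b := t)
      (D.continuous_flow u).continuousOn (fun s hs => ?_) t ⟨ht, le_rfl⟩
    · rw [h1, flow_zero]
    · rw [← hasDerivWithinAt_Ioi_iff_Ici, hasDerivWithinAt_iff_tendsto_slope' (by simp)]
      have h2 := ((D.flow s).continuous.tendsto 0).comp h
      rw [map_zero] at h2
      have h3 : Tendsto (fun x => x - s) (nhdsWithin s (Ioi s)) (nhdsWithin 0 (Ioi 0)) := by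
        refine tendsto_nhdsWithin_iff.2 ⟨?_, ?_⟩
        · exact ((continuous_sub_right s).tendsto' s 0 (sub_self s)).mono_left nhdsWithin_le_nhds
        · filter_upwards [self_mem_nhdsWithin] with x hx using mem_Ioi.2 (sub_pos.2 (mem_Ioi.1 hx))
      refine (h2.comp h3).congr' ?_
      filter_upwards [self_mem_nhdsWithin] with x hx
      rw [mem_Ioi, ← sub_pos] at hx
      rw [Function.comp_apply, Function.comp_apply, map_smul, map_sub, D.flow_flow hs.1 hx.le,
        slope_def_module, add_sub_cancel]
  ext1 j
  have h1 (t : ℝ) (ht : 0 ≤ t) :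
      ‖cutoff (Ioo (-D.τ j) 0) measurableSet_Ioo (shift t (D.ext u j))‖ = ‖D.i j (u j)‖ := by
    rw [← D.i_r, ← flow_apply, hconst t ht]
  have h2 : ‖D.i j (u j)‖ = 0 := by
    refine tendsto_nhds_unique (tendsto_const_nhds.congr' ?_)
      (tendsto_cutoff_shift_atTop (-D.τ j) 0 (D.ext u j))
    filter_upwards [eventually_ge_atTop 0] with t ht using (h1 t ht).symm
  rw [← D.r_i j (u j), norm_eq_zero.1 h2, map_zero, Pi.zero_apply]

/-- The graph of the derivative with the delay boundary condition: `u` is an absolutely continuous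
history with derivative `f`, initial values `C` and final values `b C`. -/
def Graph (u f : J → E) : Prop :=
  ∃ C : J → ℝ,
    (∀ j, ∀ᵐ x, x ∈ Ioo (-D.τ j) 0 → D.i j (u j) x = C j + ∫ y in (-D.τ j)..x, D.i j (f j) y) ∧
    ∀ j, C j + ∫ y in (-D.τ j)..0, D.i j (f j) y = ∑ k, D.b j k * C k

theorem intervalIntegrable_coeFn (g : Lp ℝ 1 (volume : Measure ℝ)) (x y : ℝ) :
    IntervalIntegrable g volume x y :=
  (L1.integrable_coeFn g).intervalIntegrable

theorem ext_primitive {u f : J → E} {C : J → ℝ}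
    (hC : ∀ j, ∀ᵐ x, x ∈ Ioo (-D.τ j) 0 →
      D.i j (u j) x = C j + ∫ y in (-D.τ j)..x, D.i j (f j) y)
    (hb : ∀ j, C j + ∫ y in (-D.τ j)..0, D.i j (f j) y = ∑ k, D.b j k * C k)
    {δ : ℝ} (hδ : ∀ k, δ ≤ D.τ k) (j : J) :
    ∀ᵐ x, x ∈ Ioo (-D.τ j) δ →
      D.ext u j x = C j + ∫ y in (-D.τ j)..x, D.ext f j y := by
  have hint (j : J) (x : ℝ) (hx : x ≤ 0) (hx' : -D.τ j ≤ x) :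
      ∫ y in (-D.τ j)..x, D.i j (f j) y = ∫ y in (-D.τ j)..x, D.ext f j y := by
    refine intervalIntegral.integral_congr_ae ?_
    filter_upwards [D.ext_ae_history f j, volume.ae_ne (0 : ℝ)] with y hy h0 hy'
    rw [uIoc_of_le hx'] at hy'
    exact (hy (lt_of_le_of_ne (hy'.2.trans hx) h0)).symm
  have hpast (j : J) : ∀ᵐ x, x ∈ Ioo (-D.τ j) 0 →
      D.ext u j x = C j + ∫ y in (-D.τ j)..x, D.ext f j y := by
    filter_upwards [D.ext_ae_history u j, hC j] with x h1 h2 hx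
    rw [h1 hx.2, h2 hx, hint j x hx.2.le hx.1.le]
  filter_upwards [hpast j, D.ext_ae_future u j, volume.ae_ne (0 : ℝ),
    ae_all_iff.2 fun k => ae_shift (hpast k) (-D.τ k)] with x h1 h2 h3 h4 hx
  rcases lt_or_gt_of_ne h3 with h0 | h0
  · exact h1 ⟨hx.1, h0⟩
  · have hτ := D.τ_pos j
    rw [h2 h0, ← intervalIntegral.integral_add_adjacent_intervals (b := 0)
      (intervalIntegrable_coeFn _ _ _) (intervalIntegrable_coeFn _ _ _), ← add_assoc,
      ← hint j 0 le_rfl (by linarith), hb j]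
    have h5 : ∫ y in (0 : ℝ)..x, D.ext f j y =
        ∑ k, D.b j k * ∫ y in (-D.τ k)..(x - D.τ k), D.ext f k y := by
      calc ∫ y in (0 : ℝ)..x, D.ext f j y
          = ∫ y in (0 : ℝ)..x, ∑ k, D.b j k * D.ext f k (y - D.τ k) := by
            refine intervalIntegral.integral_congr_ae ?_
            filter_upwards [D.ext_ae_future f j] with y hy hy'
            rw [uIoc_of_le (le_of_lt h0)] at hy'
            exact hy hy'.1
        _ = ∑ k, D.b j k * ∫ y in (0 : ℝ)..x, D.ext f k (y - D.τ k) := by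
            rw [intervalIntegral.integral_finsetSum]
            · simp_rw [intervalIntegral.integral_const_mul]
            · intro k _
              refine IntervalIntegrable.const_mul ?_ _
              simpa using (intervalIntegrable_coeFn (D.ext f k) (0 - D.τ k)
                (x - D.τ k)).comp_sub_right (D.τ k)
        _ = _ := by
            refine Finset.sum_congr rfl fun k _ => ?_
            rw [intervalIntegral.integral_comp_sub_right (fun y => D.ext f k y), zero_sub]
    rw [h5, ← Finset.sum_add_distrib]
    refine Finset.sum_congr rfl fun k _ => ?_
    rw [← mul_add, sub_eq_add_neg x, h4 k ⟨by linarith, ?_⟩]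
    have := hδ k
    have := hx.2
    linarith

theorem exists_pos_le_τ : ∃ δ > 0, ∀ k, δ ≤ D.τ k := by
  have h : ∀ᶠ δ in nhdsWithin (0 : ℝ) (Ioi 0), ∀ k, δ ≤ D.τ k := by
    rw [eventually_all]
    intro k
    filter_upwards [Ioo_mem_nhdsGT (D.τ_pos k)] with δ hδ using hδ.2.le
  obtain ⟨δ, h1, h2⟩ := (h.and self_mem_nhdsWithin).exists
  exact ⟨δ, h2, h1⟩

theorem Graph.tendsto {u f : J → E} (h : D.Graph u f) :
    Tendsto (fun t : ℝ => t⁻¹ • (D.flow t u - u)) (nhdsWithin 0 (Ioi 0)) (nhds f) := by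
  obtain ⟨C, hC, hb⟩ := h
  obtain ⟨δ, hδ, hδτ⟩ := D.exists_pos_le_τ
  refine tendsto_pi_nhds.2 fun j => ?_
  set g := D.ext u j
  set F := D.ext f j
  let A : ℝ → Lp ℝ 1 (volume : Measure ℝ) := fun t =>
    cutoff (Ioo (-D.τ j) 0) measurableSet_Ioo (t⁻¹ • (shift t g - g) - F)
  have hA : Tendsto A (nhdsWithin 0 (Ioi 0)) (nhds 0) := by
    refine Metric.tendsto_nhds.2 fun η hη => ?_
    have hc := (continuous_shift F).tendsto 0
    rw [shift_zero] at hc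
    obtain ⟨d, hd, hd'⟩ := Metric.eventually_nhds_iff.1 (Metric.tendsto_nhds.1 hc (η / 2)
      (half_pos hη))
    filter_upwards [Ioo_mem_nhdsGT (lt_min hδ hd)] with t ht
    have htδ := ht.2.trans_le (min_le_left _ _)
    have htd := ht.2.trans_le (min_le_right _ _)
    rw [dist_zero_right]
    refine lt_of_le_of_lt (norm_le_of_ae_average (F := F) ht.1 (half_pos hη).le ?_ ?_)
      (half_lt_self hη)
    · intro s hs
      rw [← dist_eq_norm]
      refine (hd' ?_).le
      rw [Real.dist_eq, sub_zero, abs_of_pos hs.1]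
      exact hs.2.trans htd
    · have hp := D.ext_primitive hC hb hδτ j
      filter_upwards [coeFn_cutoff (measurableSet_Ioo (a := -D.τ j) (b := 0))
        (t⁻¹ • (shift t g - g) - F), Lp.coeFn_sub (t⁻¹ • (shift t g - g)) F,
        Lp.coeFn_smul t⁻¹ (shift t g - g), Lp.coeFn_sub (shift t g) g, coeFn_shift t g,
        hp, ae_shift hp t] with x h1 h2 h3 h4 h5 h6 h7
      by_cases hx : x ∈ Ioo (-D.τ j) 0
      · right
        have ht0 := ht.1
        have hx1 := hx.1
        have hx2 := hx.2
        rw [h1, indicator_of_mem hx, h2, Pi.sub_apply, h3, Pi.smul_apply, h4, Pi.sub_apply, h5,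
          h6 ⟨hx1, by linarith⟩, h7 ⟨by linarith, by linarith⟩, smul_eq_mul,
          ← intervalIntegral.integral_add_adjacent_intervals (a := -D.τ j) (b := x)
          (intervalIntegrable_coeFn _ _ _) (intervalIntegrable_coeFn _ _ _)]
        ring
      · left
        rw [h1, indicator_of_notMem hx]
  have h1 := ((D.r j).continuous.tendsto 0).comp hA
  rw [map_zero] at h1
  have h2 := h1.add_const (f j)
  rw [zero_add] at h2
  refine h2.congr fun t => ?_
  simp only [Function.comp_apply, A]
  rw [r_cutoff, map_sub, map_smul, map_sub, D.r_ext, D.r_ext]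
  simp [flow_apply, g]

theorem exists_sub_mulVec_eq (d : J → ℝ) : ∃ C : J → ℝ, ∀ j, C j - ∑ k, D.b j k * C k = d j := by
  let L : (J → ℝ) →ₗ[ℝ] (J → ℝ) := LinearMap.id - D.b.mulVecLin
  have hL (C : J → ℝ) (j : J) : L C j = C j - ∑ k, D.b j k * C k := by
    simp [L, Matrix.mulVec, dotProduct]
  have hinj : Function.Injective L := by
    refine (injective_iff_map_eq_zero L).2 fun C hC => ?_
    have h1 : ‖C‖ ≤ D.q * ‖C‖ := by
      refine (pi_norm_le_iff_of_nonneg (mul_nonneg D.q_nonneg (norm_nonneg _))).2 fun j => ?_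
      have h2 : C j = ∑ k, D.b j k * C k := by
        have := hL C j
        rw [hC, Pi.zero_apply] at this
        linarith
      rw [h2]
      calc ‖∑ k, D.b j k * C k‖ ≤ ∑ k, |D.b j k| * ‖C‖ := by
            refine (norm_sum_le _ _).trans (Finset.sum_le_sum fun k _ => ?_)
            rw [norm_mul, Real.norm_eq_abs]
            gcongr
            exact norm_le_pi_norm C k
        _ ≤ D.q * ‖C‖ := by
            rw [← Finset.sum_mul]
            gcongr
            exact D.sum_abs_le j
    exact norm_le_zero_iff.1 (by nlinarith [D.q_lt_one, norm_nonneg C])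
  obtain ⟨C, hC⟩ := LinearMap.injective_iff_surjective.1 hinj d
  exact ⟨C, fun j => by rw [← hL, hC]⟩

theorem exists_graph (f : J → E) : ∃ u, D.Graph u f := by
  obtain ⟨C, hC⟩ := D.exists_sub_mulVec_eq fun j => -∫ y in (-D.τ j)..0, D.i j (f j) y
  have hmem (j : J) : MemLp ((Ioo (-D.τ j) 0).indicator
      fun x => C j + ∫ y in (-D.τ j)..x, D.i j (f j) y) 1 volume := by
    rw [memLp_one_iff_integrable, integrable_indicator_iff measurableSet_Ioo]
    have hcont : Continuous fun x => C j + ∫ y in (-D.τ j)..x, D.i j (f j) y :=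
      continuous_const.add (intervalIntegral.continuous_primitive
        (fun a b => intervalIntegrable_coeFn _ a b) _)
    exact (hcont.integrableOn_Icc (a := -D.τ j) (b := 0)).mono_set Ioo_subset_Icc_self
  refine ⟨fun j => D.r j (hmem j).toLp, C, fun j => ?_, fun j => ?_⟩
  · rw [D.i_r]
    filter_upwards [coeFn_cutoff (measurableSet_Ioo (a := -D.τ j) (b := 0)) (hmem j).toLp,
      (hmem j).coeFn_toLp] with x h1 h2 hx
    rw [h1, indicator_of_mem hx, h2, indicator_of_mem hx]
  · linarith [hC j]

theorem graph_iff_tendsto {u f : J → E} : D.Graph u f ↔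
    Tendsto (fun t : ℝ => t⁻¹ • (D.flow t u - u)) (nhdsWithin 0 (Ioi 0)) (nhds f) := by
  refine ⟨fun h => h.tendsto, fun h => ?_⟩
  obtain ⟨v, hv⟩ := D.exists_graph f
  have h1 := h.sub hv.tendsto
  rw [sub_self] at h1
  have h2 : u - v = 0 := by
    refine D.eq_zero_of_tendsto_zero (h1.congr fun t => ?_)
    rw [map_sub, ← smul_sub]
    congr 1
    abel
  rwa [sub_eq_zero.1 h2]

end DelaySystem

/-- Product rule, in integrated form, for the product of a `C¹` function with a primitive of an
integrable function. -/
theorem mul_primitive_eq {p p' g' : ℝ → ℝ} (hp : ∀ x, HasDerivAt p (p' x) x)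
    (hp' : Continuous p') {a x : ℝ} (hg' : IntervalIntegrable g' volume a x) (K : ℝ) :
    p x * (K + ∫ y in a..x, g' y) =
      p a * K + ∫ y in a..x, (p' y * (K + ∫ s in a..y, g' s) + p y * g' y) := by
  have hderiv : deriv p = p' := funext fun x => (hp x).deriv
  have hpd : ContDiff ℝ 1 p :=
    contDiff_one_iff_deriv.2 ⟨fun x => (hp x).differentiableAt, hderiv ▸ hp'⟩
  have hpAC : AbsolutelyContinuousOnInterval p a x :=
    hpd.contDiffOn.absolutelyContinuousOnInterval
  have hgAC : AbsolutelyContinuousOnInterval (fun y => K + ∫ s in a..y, g' s) a x := by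
    have h1 : AbsolutelyContinuousOnInterval (fun _ : ℝ => K) a x :=
      (contDiff_const (n := 1)).contDiffOn.absolutelyContinuousOnInterval
    exact h1.add (hg'.absolutelyContinuousOnInterval_intervalIntegral left_mem_uIcc)
  have h := AbsolutelyContinuousOnInterval.integral_deriv_mul_eq_sub hpAC hgAC
  rw [intervalIntegral.integral_same, add_zero] at h
  rw [eq_comm, ← eq_sub_iff_add_eq', ← h]
  refine intervalIntegral.integral_congr_ae ?_
  filter_upwards [hg'.ae_hasDerivAt_integral] with y hy hyx
  have h2 := (hy (uIoc_subset_uIcc hyx) a left_mem_uIcc).const_add K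
  rw [h2.deriv, hderiv]

theorem intervalIntegrable_of_integrableOn_Ioo {f : ℝ → ℝ} (hf : IntegrableOn f (Ioo 0 1))
    {a b : ℝ} (ha : a ∈ Icc (0 : ℝ) 1) (hb : b ∈ Icc (0 : ℝ) 1) :
    IntervalIntegrable f volume a b := by
  have h : IntervalIntegrable f volume 0 1 :=
    (intervalIntegrable_iff_integrableOn_Ioo_of_le zero_le_one).2 hf
  refine h.mono_set ?_
  rw [uIcc_of_le (zero_le_one' ℝ)]
  exact uIcc_subset_Icc ha hb

theorem ae_mem_uIoc_imp {p : ℝ → Prop} (hp : ∀ᵐ x ∂mu01, p x) {a b : ℝ} (ha : a ∈ Icc (0 : ℝ) 1)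
    (hb : b ∈ Icc (0 : ℝ) 1) : ∀ᵐ x, x ∈ uIoc a b → p x := by
  rw [mu01, ae_restrict_iff' measurableSet_Ioo] at hp
  filter_upwards [hp, volume.ae_ne (0 : ℝ), volume.ae_ne (1 : ℝ)] with x h1 h2 h3 hx
  have h4 : x ∈ Icc (0 : ℝ) 1 := uIcc_subset_Icc ha hb (uIoc_subset_uIcc hx)
  exact h1 ⟨lt_of_le_of_ne h4.1 (Ne.symm h2), lt_of_le_of_ne h4.2 h3⟩

/-- A travel-time coordinate `σ` on `[0,1]` for a transport equation with speed `c` and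
direction `e = ±1`: it vanishes at the entry point `z` and equals `-τ` at the exit point `a`. -/
structure TravelChart (c : ℝ → ℝ) (e a z : ℝ) where
  σ : ℝ → ℝ
  ψ : ℝ → ℝ
  σ' : ℝ → ℝ
  τ : ℝ
  τ_pos : 0 < τ
  exit_mem : a ∈ Icc (0 : ℝ) 1
  entry_mem : z ∈ Icc (0 : ℝ) 1
  hasDerivAt : ∀ x, HasDerivAt σ (σ' x) x
  continuous_deriv : Continuous σ'
  deriv_ne : ∀ x, σ' x ≠ 0
  speed_mul : ∀ x ∈ Icc (0 : ℝ) 1, e * c x * σ' x = 1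
  ψ_σ : ∀ x, ψ (σ x) = x
  σ_ψ : ∀ s, σ (ψ s) = s
  measurable_ψ : Measurable ψ
  σ_exit : σ a = -τ
  σ_entry : σ z = 0
  image_Ioo : σ '' Ioo 0 1 = Ioo (-τ) 0
  integral_comp : ∀ (F : ℝ → ℝ), ∀ x ∈ Icc (0 : ℝ) 1,
    ∫ s in (-τ)..σ x, F s = ∫ y in a..x, σ' y * F (σ y)

theorem exists_travelTime {c : ℝ → ℝ} (hc : ContinuousOn c (Icc 0 1))
    (hpos : ∀ x ∈ Icc (0 : ℝ) 1, 0 < c x) : ∃ (θ : ℝ ≃o ℝ) (k : ℝ → ℝ), Continuous k ∧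
      (∀ x, 0 < k x) ∧ (∀ x ∈ Icc (0 : ℝ) 1, c x * k x = 1) ∧ (∀ x, HasDerivAt θ (k x) x) ∧
      θ 0 = 0 := by
  let C : ℝ → ℝ := IccExtend zero_le_one ((Icc (0 : ℝ) 1).domRestrict c)
  have hC : Continuous C := (continuousOn_iff_continuous_domRestrict.1 hc).Icc_extend'
  have hCpos (x : ℝ) : 0 < C x := hpos _ (projIcc (0 : ℝ) 1 zero_le_one x).2
  have hCc (x : ℝ) (hx : x ∈ Icc (0 : ℝ) 1) : C x = c x := IccExtend_of_mem _ _ hx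
  obtain ⟨M, hM⟩ : ∃ M, ∀ x, C x ≤ M := by
    obtain ⟨M, hM⟩ := isCompact_Icc.exists_bound_of_continuousOn hc
    exact ⟨M, fun x => (le_abs_self _).trans (hM _ (projIcc (0 : ℝ) 1 zero_le_one x).2)⟩
  have hMpos : 0 < M := (hCpos 0).trans_le (hM 0)
  let k : ℝ → ℝ := fun x => (C x)⁻¹
  have hk : Continuous k := hC.inv₀ fun x => (hCpos x).ne'
  have hkpos (x : ℝ) : 0 < k x := inv_pos.2 (hCpos x)
  let T : ℝ → ℝ := fun x => ∫ y in (0 : ℝ)..x, k y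
  have hT (x : ℝ) : HasDerivAt T (k x) x :=
    intervalIntegral.integral_hasDerivAt_right (hk.intervalIntegrable _ _)
      hk.stronglyMeasurable.stronglyMeasurableAtFilter hk.continuousAt
  have hTc : Continuous T := continuous_iff_continuousAt.2 fun x => (hT x).continuousAt
  have hmono : StrictMono T := strictMono_of_deriv_pos fun x => by rw [(hT x).deriv]; exact hkpos x
  have hlow : Monotone fun x => T x - M⁻¹ * x := by
    have hd (x : ℝ) : HasDerivAt (fun x => T x - M⁻¹ * x) (k x - M⁻¹ * 1) x :=
      (hT x).sub ((hasDerivAt_id x).const_mul _)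
    refine monotone_of_deriv_nonneg (fun x => (hd x).differentiableAt) fun x => ?_
    rw [(hd x).deriv, mul_one, sub_nonneg]
    exact inv_anti₀ (hCpos x) (hM x)
  have hT0 : T 0 = 0 := intervalIntegral.integral_same
  have hM' : 0 < M⁻¹ := inv_pos.2 hMpos
  have htop : Tendsto T atTop atTop := by
    refine tendsto_atTop_mono' _ ?_ (tendsto_id.const_mul_atTop hM')
    filter_upwards [eventually_ge_atTop 0] with x hx
    have := hlow hx
    simp only [hT0, mul_zero, sub_zero] at this
    simpa using this
  have hbot : Tendsto T atBot atBot := by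
    refine tendsto_atBot_mono' _ ?_ (tendsto_id.const_mul_atBot hM')
    filter_upwards [eventually_le_atBot 0] with x hx
    have := hlow hx
    simp only [hT0, mul_zero, sub_zero] at this
    simpa using this
  refine ⟨hmono.orderIsoOfSurjective T (hTc.surjective htop hbot), k, hk, hkpos,
    fun x hx => ?_, hT, hT0⟩
  rw [← hCc x hx]
  exact mul_inv_cancel₀ (hCpos x).ne'

theorem nonempty_travelChart_forward {c : ℝ → ℝ} (hc : ContinuousOn c (Icc 0 1))
    (hpos : ∀ x ∈ Icc (0 : ℝ) 1, 0 < c x) : Nonempty (TravelChart c (-1) 1 0) := by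
  obtain ⟨θ, k, hk, hkpos, hck, hθ, hθ0⟩ := exists_travelTime hc hpos
  have hder (x : ℝ) : HasDerivAt (fun x => -θ x) (-k x) x := (hθ x).neg
  have hinj : Function.Injective fun x => -θ x := neg_injective.comp θ.injective
  have himage (x y : ℝ) : (fun x => -θ x) '' Ioo x y = Ioo (-θ y) (-θ x) := by
    rw [← image_image (fun x => -x) θ, θ.image_Ioo, image_neg_Ioo]
  refine ⟨{
    σ := fun x => -θ x
    ψ := fun s => θ.symm (-s)
    σ' := fun x => -k x
    τ := θ 1
    τ_pos := hθ0 ▸ θ.strictMono zero_lt_one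
    exit_mem := ⟨zero_le_one, le_rfl⟩
    entry_mem := ⟨le_rfl, zero_le_one⟩
    hasDerivAt := hder
    continuous_deriv := hk.neg
    deriv_ne := fun x => neg_ne_zero.2 (hkpos x).ne'
    speed_mul := fun x hx => by linarith [hck x hx]
    ψ_σ := fun x => by simp
    σ_ψ := fun s => by simp
    measurable_ψ := θ.symm.continuous.measurable.comp measurable_neg
    σ_exit := rfl
    σ_entry := by rw [hθ0, neg_zero]
    image_Ioo := by rw [himage, hθ0, neg_zero]
    integral_comp := fun F x hx => ?_ }⟩
  rw [intervalIntegral.integral_of_le (neg_le_neg (θ.monotone hx.2)), integral_Ioc_eq_integral_Ioo,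
    ← himage, integral_image_eq_integral_abs_deriv_smul measurableSet_Ioo
      (fun x _ => (hder x).hasDerivWithinAt) hinj.injOn, intervalIntegral.integral_of_ge hx.2,
    integral_Ioc_eq_integral_Ioo, ← integral_neg]
  refine integral_congr_ae (ae_of_all _ fun y => ?_)
  simp [abs_of_pos (hkpos y)]

theorem nonempty_travelChart_backward {c : ℝ → ℝ} (hc : ContinuousOn c (Icc 0 1))
    (hpos : ∀ x ∈ Icc (0 : ℝ) 1, 0 < c x) : Nonempty (TravelChart c 1 0 1) := by
  obtain ⟨θ, k, hk, hkpos, hck, hθ, hθ0⟩ := exists_travelTime hc hpos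
  have hder (x : ℝ) : HasDerivAt (fun x => θ x - θ 1) (k x) x := (hθ x).sub_const _
  have hinj : Function.Injective fun x => θ x - θ 1 := sub_left_injective.comp θ.injective
  have himage (x y : ℝ) : (fun x => θ x - θ 1) '' Ioo x y = Ioo (θ x - θ 1) (θ y - θ 1) := by
    rw [← image_image (fun x => x - θ 1) θ, θ.image_Ioo, image_sub_const_Ioo]
  refine ⟨{
    σ := fun x => θ x - θ 1
    ψ := fun s => θ.symm (s + θ 1)
    σ' := k
    τ := θ 1
    τ_pos := hθ0 ▸ θ.strictMono zero_lt_one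
    exit_mem := ⟨le_rfl, zero_le_one⟩
    entry_mem := ⟨zero_le_one, le_rfl⟩
    hasDerivAt := hder
    continuous_deriv := hk
    deriv_ne := fun x => (hkpos x).ne'
    speed_mul := fun x hx => by linarith [hck x hx]
    ψ_σ := fun x => by simp
    σ_ψ := fun s => by simp
    measurable_ψ := θ.symm.continuous.measurable.comp (measurable_add_const _)
    σ_exit := by rw [hθ0, zero_sub]
    σ_entry := sub_self _
    image_Ioo := by rw [himage, hθ0, zero_sub, sub_self]
    integral_comp := fun F x hx => ?_ }⟩
  have h0 : -θ 1 = θ 0 - θ 1 := by rw [hθ0, zero_sub]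
  rw [h0, intervalIntegral.integral_of_le (sub_le_sub_right (θ.monotone hx.1) _),
    integral_Ioc_eq_integral_Ioo,
    ← himage, integral_image_eq_integral_abs_deriv_smul measurableSet_Ioo
      (fun x _ => (hder x).hasDerivWithinAt) hinj.injOn, intervalIntegral.integral_of_le hx.1,
    integral_Ioc_eq_integral_Ioo]
  refine integral_congr_ae (ae_of_all _ fun y => ?_)
  simp [abs_of_pos (hkpos y)]

namespace TravelChart

variable {c : ℝ → ℝ} {e a z : ℝ} (D : TravelChart c e a z)

theorem continuous_σ : Continuous D.σ :=
  continuous_iff_continuousAt.2 fun x => (D.hasDerivAt x).continuousAt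

theorem injective_σ : Function.Injective D.σ := Function.LeftInverse.injective D.ψ_σ

theorem σ_mem {x : ℝ} (hx : x ∈ Ioo (0 : ℝ) 1) : D.σ x ∈ Ioo (-D.τ) 0 :=
  D.image_Ioo ▸ mem_image_of_mem D.σ hx

theorem ψ_mem {s : ℝ} (hs : s ∈ Ioo (-D.τ) 0) : D.ψ s ∈ Ioo (0 : ℝ) 1 := by
  rw [← D.image_Ioo] at hs
  obtain ⟨x, hx, rfl⟩ := hs
  rwa [D.ψ_σ]

theorem lintegral_Ioo_comp (f : ℝ → ℝ≥0∞) :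
    ∫⁻ s in Ioo (-D.τ) 0, f s = ∫⁻ x in Ioo 0 1, ENNReal.ofReal |D.σ' x| * f (D.σ x) := by
  rw [← D.image_Ioo, lintegral_image_eq_lintegral_abs_deriv_mul measurableSet_Ioo
    (fun x _ => (D.hasDerivAt x).hasDerivWithinAt) D.injective_σ.injOn]

theorem exists_wCompBound_pull (l : ℝ) : ∃ C, WCompBound mu01 volume D.ψ
    ((Ioo (-D.τ) 0).indicator fun s => Real.exp (-(l * s))) C := by
  have hcont : ContinuousOn (fun x => D.σ' x * Real.exp (-(l * D.σ x))) (Icc 0 1) := by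
    have h1 := D.continuous_σ
    have h2 := D.continuous_deriv
    fun_prop
  obtain ⟨C, hC⟩ := isCompact_Icc.exists_bound_of_continuousOn hcont
  refine ⟨C.toNNReal, D.measurable_ψ,
    Measurable.indicator (by fun_prop) measurableSet_Ioo, fun f hf => ?_⟩
  have h1 : ∀ s, ‖(Ioo (-D.τ) 0).indicator (fun s => Real.exp (-(l * s))) s‖ₑ * f (D.ψ s) =
      (Ioo (-D.τ) 0).indicator (fun s => ‖Real.exp (-(l * s))‖ₑ * f (D.ψ s)) s := fun s => by
    by_cases hs : s ∈ Ioo (-D.τ) 0 <;> simp [hs]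
  simp_rw [h1]
  rw [lintegral_indicator measurableSet_Ioo, D.lintegral_Ioo_comp, mu01,
    ← lintegral_const_mul _ hf]
  refine setLIntegral_mono' measurableSet_Ioo fun x hx => ?_
  rw [D.ψ_σ, ← mul_assoc]
  gcongr
  have h2 := hC x (Ioo_subset_Icc_self hx)
  rw [← Real.norm_eq_abs, ofReal_norm, ← enorm_mul, ← ofReal_norm]
  exact ENNReal.ofReal_le_ofReal h2

theorem exists_wCompBound_push (l : ℝ) :
    ∃ C, WCompBound volume mu01 D.σ (fun x => Real.exp (l * D.σ x)) C := by
  have hcont : ContinuousOn (fun x => Real.exp (l * D.σ x) / D.σ' x) (Icc 0 1) := by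
    have h1 := D.continuous_σ
    have h2 := D.continuous_deriv
    exact (Continuous.div (by fun_prop) h2 D.deriv_ne).continuousOn
  obtain ⟨C, hC⟩ := isCompact_Icc.exists_bound_of_continuousOn hcont
  have hσ := D.continuous_σ
  have hσ' := D.continuous_deriv
  refine ⟨C.toNNReal, D.continuous_σ.measurable, by fun_prop, fun f hf => ?_⟩
  calc ∫⁻ x in Ioo 0 1, ‖Real.exp (l * D.σ x)‖ₑ * f (D.σ x)
      ≤ ∫⁻ x in Ioo 0 1, C.toNNReal * (ENNReal.ofReal |D.σ' x| * f (D.σ x)) := by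
        refine setLIntegral_mono' measurableSet_Ioo fun x hx => ?_
        rw [← mul_assoc]
        gcongr
        have h2 := hC x (Ioo_subset_Icc_self hx)
        have h3 : Real.exp (l * D.σ x) = Real.exp (l * D.σ x) / D.σ' x * D.σ' x :=
          (div_mul_cancel₀ _ (D.deriv_ne x)).symm
        rw [h3, enorm_mul, ← Real.norm_eq_abs, ofReal_norm]
        gcongr
        rw [← ofReal_norm]
        exact ENNReal.ofReal_le_ofReal h2
    _ = C.toNNReal * ∫⁻ s in Ioo (-D.τ) 0, f s := by
        rw [D.lintegral_Ioo_comp, lintegral_const_mul]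
        exact (by fun_prop : Measurable fun x => ENNReal.ofReal |D.σ' x|).mul
          (hf.comp D.continuous_σ.measurable)
    _ ≤ C.toNNReal * ∫⁻ s, f s := by
        exact mul_le_mul_right (setLIntegral_le_lintegral _ _) _

/-- The profile `u` in travel-time coordinates, with exponential weight of rate `l`,
extended by zero. -/
noncomputable def pull (l : ℝ) : Lp ℝ 1 mu01 →L[ℝ] Lp ℝ 1 (volume : Measure ℝ) :=
  wcomp (D.exists_wCompBound_pull l).choose_spec

/-- The left inverse of `TravelChart.pull`. -/
noncomputable def push (l : ℝ) : Lp ℝ 1 (volume : Measure ℝ) →L[ℝ] Lp ℝ 1 mu01 :=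
  wcomp (D.exists_wCompBound_push l).choose_spec

theorem coeFn_pull (l : ℝ) (u : Lp ℝ 1 mu01) : D.pull l u =ᵐ[volume] fun s =>
    (Ioo (-D.τ) 0).indicator (fun s => Real.exp (-(l * s))) s * u (D.ψ s) :=
  coeFn_wcomp _ u

theorem coeFn_push (l : ℝ) (g : Lp ℝ 1 (volume : Measure ℝ)) : D.push l g =ᵐ[mu01] fun x =>
    Real.exp (l * D.σ x) * g (D.σ x) :=
  coeFn_wcomp _ g

theorem ae_comp_σ {p : ℝ → Prop} (hp : ∀ᵐ s, p s) : ∀ᵐ x ∂mu01, p (D.σ x) := by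
  filter_upwards [(D.exists_wCompBound_push 0).choose_spec.ae_of_ae hp] with x hx
  exact hx (Real.exp_ne_zero _)

theorem ae_comp_ψ {p : ℝ → Prop} (hp : ∀ᵐ x ∂mu01, p x) :
    ∀ᵐ s, s ∈ Ioo (-D.τ) 0 → p (D.ψ s) := by
  filter_upwards [(D.exists_wCompBound_pull 0).choose_spec.ae_of_ae hp] with s hs hmem
  exact hs (by simp [indicator_of_mem hmem])

theorem ae_mem : ∀ᵐ x ∂mu01, x ∈ Ioo (0 : ℝ) 1 := ae_restrict_mem measurableSet_Ioo

theorem pull_comp_σ (l : ℝ) (u : Lp ℝ 1 mu01) :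
    ∀ᵐ x ∂mu01, D.pull l u (D.σ x) = Real.exp (-(l * D.σ x)) * u x := by
  filter_upwards [D.ae_comp_σ (D.coeFn_pull l u), ae_mem] with x hx hmem
  rw [hx, indicator_of_mem (D.σ_mem hmem), D.ψ_σ]

theorem push_pull (l : ℝ) (u : Lp ℝ 1 mu01) : D.push l (D.pull l u) = u := by
  refine Lp.ext ?_
  filter_upwards [D.coeFn_push l (D.pull l u), D.pull_comp_σ l u] with x h1 h2
  rw [h1, h2, ← mul_assoc, ← Real.exp_add, add_neg_cancel, Real.exp_zero, one_mul]

theorem pull_push (l : ℝ) (g : Lp ℝ 1 (volume : Measure ℝ)) :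
    D.pull l (D.push l g) = cutoff (Ioo (-D.τ) 0) measurableSet_Ioo g := by
  refine Lp.ext ?_
  filter_upwards [D.coeFn_pull l (D.push l g), coeFn_cutoff measurableSet_Ioo g,
    D.ae_comp_ψ (D.coeFn_push l g)] with s h1 h2 h3
  rw [h1, h2]
  by_cases hs : s ∈ Ioo (-D.τ) 0
  · rw [indicator_of_mem hs, indicator_of_mem hs, h3 hs, D.σ_ψ, ← mul_assoc, ← Real.exp_add,
      neg_add_cancel, Real.exp_zero, one_mul]
  · rw [indicator_of_notMem hs, indicator_of_notMem hs, zero_mul]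

theorem integral_pull (l : ℝ) (u : Lp ℝ 1 mu01) {x : ℝ} (hx : x ∈ Icc (0 : ℝ) 1) :
    ∫ s in (-D.τ)..D.σ x, D.pull l u s =
      ∫ y in a..x, D.σ' y * (Real.exp (-(l * D.σ y)) * u y) := by
  rw [D.integral_comp _ x hx]
  refine intervalIntegral.integral_congr_ae ?_
  filter_upwards [ae_mem_uIoc_imp (D.pull_comp_σ l u) D.exit_mem hx] with y hy hmem
  rw [hy hmem]

theorem ae_pull_eq_iff (l : ℝ) (u f : Lp ℝ 1 mu01) (C : ℝ) :
    (∀ᵐ s, s ∈ Ioo (-D.τ) 0 → D.pull l u s = C + ∫ y in (-D.τ)..s, D.pull l f y) ↔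
      ∀ᵐ x ∂mu01, Real.exp (-(l * D.σ x)) * u x =
        C + ∫ y in a..x, D.σ' y * (Real.exp (-(l * D.σ y)) * f y) := by
  constructor
  · intro h
    filter_upwards [D.ae_comp_σ h, D.pull_comp_σ l u, ae_mem] with x h1 h2 hx
    rw [← h2, h1 (D.σ_mem hx), D.integral_pull l f (Ioo_subset_Icc_self hx)]
  · intro h
    filter_upwards [D.ae_comp_ψ h, D.ae_comp_ψ (D.pull_comp_σ l u)] with s h1 h2 hs
    have h3 := D.integral_pull l f (Ioo_subset_Icc_self (D.ψ_mem hs))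
    rw [D.σ_ψ] at h3
    have h4 := h1 hs
    have h5 := h2 hs
    rw [D.σ_ψ] at h4 h5
    rw [h5, h4, h3]

theorem integrable_mul {h u : ℝ → ℝ} (hh : Continuous h) (hu : Integrable u mu01) :
    IntegrableOn (fun x => h x * u x) (Ioo 0 1) := by
  have h1 : IntegrableOn u (Icc 0 1) := (integrableOn_Icc_iff_integrableOn_Ioo).2 hu
  exact (integrableOn_Icc_iff_integrableOn_Ioo).1
    (h1.continuousOn_mul hh.continuousOn isCompact_Icc)

theorem coeFn_sub_smul (l : ℝ) (u f : Lp ℝ 1 mu01) :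
    (f - l • u : Lp ℝ 1 mu01) =ᵐ[mu01] fun x => f x - l * u x := by
  filter_upwards [Lp.coeFn_sub f (l • u), Lp.coeFn_smul l u] with x h1 h2
  rw [h1, Pi.sub_apply, h2, Pi.smul_apply, smul_eq_mul]

theorem hasDerivAt_exp_mul (l x : ℝ) :
    HasDerivAt (fun x => Real.exp (l * D.σ x)) (l * D.σ' x * Real.exp (l * D.σ x)) x := by
  convert ((D.hasDerivAt x).const_mul l).exp using 1
  ring

theorem continuous_deriv_exp (l : ℝ) :
    Continuous fun x => l * D.σ' x * Real.exp (l * D.σ x) := by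
  have h1 := D.continuous_σ
  have h2 := D.continuous_deriv
  fun_prop

theorem _root_.IsW11Rep.eq_add_integral {g g' : ℝ → ℝ} (h : IsW11Rep g g') {x y : ℝ}
    (hx : x ∈ Icc (0 : ℝ) 1) (hy : y ∈ Icc (0 : ℝ) 1) : g y = g x + ∫ t in x..y, g' t := by
  have h0 : (0 : ℝ) ∈ Icc (0 : ℝ) 1 := ⟨le_rfl, zero_le_one⟩
  rw [h.2.2 y hy, h.2.2 x hx, add_assoc, intervalIntegral.integral_add_adjacent_intervals
    (intervalIntegrable_of_integrableOn_Ioo h.2.1 h0 hx)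
    (intervalIntegrable_of_integrableOn_Ioo h.2.1 hx hy)]

theorem exp_mul_eq_of_isW11Rep (l : ℝ) {u f : Lp ℝ 1 mu01} {g g' : ℝ → ℝ} (hg : IsW11Rep g g')
    (hu : u =ᵐ[mu01] g) (hf : f =ᵐ[mu01] fun x => e * (c x * g' x)) {x : ℝ}
    (hx : x ∈ Icc (0 : ℝ) 1) : Real.exp (-(l * D.σ x)) * g x =
      Real.exp (l * D.τ) * g a +
        ∫ y in a..x, D.σ' y * (Real.exp (-(l * D.σ y)) * (f - l • u : Lp ℝ 1 mu01) y) := by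
  have hg' := intervalIntegrable_of_integrableOn_Ioo hg.2.1 D.exit_mem hx
  have h := mul_primitive_eq (D.hasDerivAt_exp_mul (-l)) (D.continuous_deriv_exp (-l)) hg' (g a)
  rw [← hg.eq_add_integral D.exit_mem hx, D.σ_exit, neg_mul_neg, neg_mul] at h
  rw [h]
  congr 1
  refine intervalIntegral.integral_congr_ae ?_
  have h1 : ∀ᵐ y ∂mu01, y ∈ Icc (0 : ℝ) 1 ∧
      (f - l • u : Lp ℝ 1 mu01) y = e * (c y * g' y) - l * g y := by
    filter_upwards [hu, hf, coeFn_sub_smul l u f, ae_mem] with y h2 h3 h4 h5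
    exact ⟨Ioo_subset_Icc_self h5, by rw [h4, h2, h3]⟩
  filter_upwards [ae_mem_uIoc_imp h1 D.exit_mem hx] with y hy hmem
  obtain ⟨hy1, hy2⟩ := hy hmem
  have h3 := D.speed_mul y hy1
  rw [hy2, ← hg.eq_add_integral D.exit_mem hy1, neg_mul l (D.σ y)]
  linear_combination (-Real.exp (-(l * D.σ y)) * g' y) * h3

theorem exists_isW11Rep (l : ℝ) {u f : Lp ℝ 1 mu01} {C : ℝ}
    (h : ∀ᵐ x ∂mu01, Real.exp (-(l * D.σ x)) * u x = C +
      ∫ y in a..x, D.σ' y * (Real.exp (-(l * D.σ y)) * (f - l • u : Lp ℝ 1 mu01) y)) :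
    ∃ g g', IsW11Rep g g' ∧ u =ᵐ[mu01] g ∧ f =ᵐ[mu01] fun x => e * (c x * g' x) := by
  set H : ℝ → ℝ := fun y =>
    D.σ' y * (Real.exp (-(l * D.σ y)) * (f - l • u : Lp ℝ 1 mu01) y) with hH
  set g : ℝ → ℝ := fun x => Real.exp (l * D.σ x) * (C + ∫ y in a..x, H y) with hgdef
  have hug : u =ᵐ[mu01] g := by
    filter_upwards [h] with x hx
    rw [hgdef]
    simp only
    rw [← hx, ← mul_assoc, ← Real.exp_add, add_neg_cancel, Real.exp_zero, one_mul]
  have hσ := D.continuous_σ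
  have hHint : IntegrableOn H (Ioo 0 1) := by
    have := integrable_mul (h := fun y => D.σ' y * Real.exp (-(l * D.σ y)))
      (D.continuous_deriv.mul (by fun_prop)) (L1.integrable_coeFn (f - l • u : Lp ℝ 1 mu01))
    simpa only [mul_assoc] using this
  have hfint : IntegrableOn (fun y => D.σ' y * f y) (Ioo 0 1) :=
    integrable_mul D.continuous_deriv (L1.integrable_coeFn f)
  have hprim (x : ℝ) (hx : x ∈ Icc (0 : ℝ) 1) :
      g x = Real.exp (l * D.σ a) * C + ∫ y in a..x, D.σ' y * f y := by
    rw [hgdef]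
    simp only
    rw [mul_primitive_eq (D.hasDerivAt_exp_mul l) (D.continuous_deriv_exp l)
      (intervalIntegrable_of_integrableOn_Ioo hHint D.exit_mem hx) C]
    congr 1
    refine intervalIntegral.integral_congr_ae ?_
    have h1 : ∀ᵐ y ∂mu01, u y = g y ∧ (f - l • u : Lp ℝ 1 mu01) y = f y - l * u y := by
      filter_upwards [hug, coeFn_sub_smul l u f] with y h2 h3
      exact ⟨h2, h3⟩
    filter_upwards [ae_mem_uIoc_imp h1 D.exit_mem hx] with y hy hmem
    obtain ⟨hy1, hy2⟩ := hy hmem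
    have h3 : Real.exp (l * D.σ y) * Real.exp (-(l * D.σ y)) = 1 := by
      rw [← Real.exp_add, add_neg_cancel, Real.exp_zero]
    have h4 : l * D.σ' y * Real.exp (l * D.σ y) * (C + ∫ s in a..y, H s) = l * D.σ' y * u y := by
      rw [hy1, hgdef]
      ring
    rw [h4, hH]
    simp only
    rw [hy2]
    linear_combination (D.σ' y * (f y - l * u y)) * h3
  have h0 : (0 : ℝ) ∈ Icc (0 : ℝ) 1 := ⟨le_rfl, zero_le_one⟩
  refine ⟨g, fun y => D.σ' y * f y,
    ⟨(L1.integrable_coeFn u).congr hug, hfint, fun x hx => ?_⟩, hug, ?_⟩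
  · rw [hprim x hx, hprim 0 h0, add_assoc, intervalIntegral.integral_add_adjacent_intervals
      (intervalIntegrable_of_integrableOn_Ioo hfint D.exit_mem h0)
      (intervalIntegrable_of_integrableOn_Ioo hfint h0 hx)]
  · filter_upwards [ae_mem] with y hy
    linear_combination (-f y) * D.speed_mul y (Ioo_subset_Icc_self hy)

end TravelChart

section Network

variable {J : Type*} [Fintype J] {c : J → ℝ → ℝ} {e a z : J → ℝ}

theorem exists_decay_rate (τ : J → ℝ) (hτ : ∀ j, 0 < τ j) (B : Matrix J J ℝ) :
    ∃ l : ℝ, ∀ j, ∑ k, |B j k * Real.exp (-(l * τ k))| ≤ 1 / 2 := by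
  have h (j : J) : ∀ᶠ l : ℝ in atTop, ∑ k, |B j k * Real.exp (-(l * τ k))| ≤ 1 / 2 := by
    have h1 : Tendsto (fun l : ℝ => ∑ k, |B j k * Real.exp (-(l * τ k))|) atTop
        (nhds (∑ k, |B j k * 0|)) := by
      refine tendsto_finsetSum _ fun k _ => (Tendsto.const_mul _ ?_).abs
      exact Real.tendsto_exp_neg_atTop_nhds_zero.comp (tendsto_id.atTop_mul_const (hτ k))
    simp only [mul_zero, abs_zero, Finset.sum_const_zero] at h1
    exact h1.eventually_le_const (by norm_num)
  exact (eventually_all.2 h).exists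

/-- The delay system describing a network of transport equations in travel-time coordinates. -/
noncomputable def networkDelaySystem (ch : ∀ j, TravelChart (c j) (e j) (a j) (z j))
    (B : Matrix J J ℝ) (l : ℝ)
    (hl : ∀ j, ∑ k, |B j k * Real.exp (-(l * (ch k).τ))| ≤ 1 / 2) :
    DelaySystem J (Lp ℝ 1 mu01) where
  τ j := (ch j).τ
  τ_pos j := (ch j).τ_pos
  b := Matrix.of fun j k => B j k * Real.exp (-(l * (ch k).τ))
  q := 1 / 2
  q_nonneg := by norm_num
  q_lt_one := by norm_num
  sum_abs_le := hl
  i j := (ch j).pull l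
  r j := (ch j).push l
  r_i j := (ch j).push_pull l
  i_r j := (ch j).pull_push l

theorem graph_networkDelaySystem_iff (ch : ∀ j, TravelChart (c j) (e j) (a j) (z j))
    (B : Matrix J J ℝ) (l : ℝ)
    (hl : ∀ j, ∑ k, |B j k * Real.exp (-(l * (ch k).τ))| ≤ 1 / 2) (u f : J → Lp ℝ 1 mu01) :
    (networkDelaySystem ch B l hl).Graph u (f - l • u) ↔
      ∃ g g' : J → ℝ → ℝ, (∀ j, IsW11Rep (g j) (g' j)) ∧ (∀ j, u j =ᵐ[mu01] g j) ∧
        (∀ j, f j =ᵐ[mu01] fun x => e j * (c j x * g' j x)) ∧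
        ∀ j, g j (z j) = ∑ k, B j k * g k (a k) := by
  have hne : NeBot (ae mu01) := by
    rw [ae_neBot, mu01, Ne, Measure.restrict_eq_zero]
    simp
  have hz (g g' : J → ℝ → ℝ) (hg : ∀ j, IsW11Rep (g j) (g' j)) (hu : ∀ j, u j =ᵐ[mu01] g j)
      (hf : ∀ j, f j =ᵐ[mu01] fun x => e j * (c j x * g' j x)) (j : J) :
      g j (z j) = Real.exp (l * (ch j).τ) * g j (a j) +
        ∫ y in (-(ch j).τ)..0, (ch j).pull l (f j - l • u j) y := by
    have h1 := (ch j).exp_mul_eq_of_isW11Rep l (hg j) (hu j) (hf j) (ch j).entry_mem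
    rw [← (ch j).integral_pull l _ (ch j).entry_mem, (ch j).σ_entry] at h1
    simpa using h1
  have hexp (k : J) : Real.exp (-(l * (ch k).τ)) * Real.exp (l * (ch k).τ) = 1 := by
    rw [← Real.exp_add, neg_add_cancel, Real.exp_zero]
  constructor
  · rintro ⟨C, h1, h2⟩
    have h3 (j : J) := ((ch j).ae_pull_eq_iff l (u j) (f j - l • u j) (C j)).1 (h1 j)
    choose g g' hg hu hf using fun j => (ch j).exists_isW11Rep l (h3 j)
    have hC (j : J) : C j = Real.exp (l * (ch j).τ) * g j (a j) := by
      obtain ⟨x, hx1, hx2, hx3⟩ := ((h3 j).and ((hu j).and TravelChart.ae_mem)).exists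
      have h4 := (ch j).exp_mul_eq_of_isW11Rep l (hg j) (hu j) (hf j) (Ioo_subset_Icc_self hx3)
      rw [← hx2, hx1] at h4
      exact add_right_cancel h4
    refine ⟨g, g', hg, hu, hf, fun j => ?_⟩
    rw [hz g g' hg hu hf j, ← hC j]
    refine (h2 j).trans (Finset.sum_congr rfl fun k _ => ?_)
    rw [hC k]
    change B j k * Real.exp (-(l * (ch k).τ)) * _ = _
    linear_combination (B j k * g k (a k)) * hexp k
  · rintro ⟨g, g', hg, hu, hf, hB⟩
    refine ⟨fun j => Real.exp (l * (ch j).τ) * g j (a j), fun j => ?_, fun j => ?_⟩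
    · refine ((ch j).ae_pull_eq_iff l (u j) (f j - l • u j) _).2 ?_
      filter_upwards [hu j, TravelChart.ae_mem] with x hx1 hx2
      rw [hx1]
      exact (ch j).exp_mul_eq_of_isW11Rep l (hg j) (hu j) (hf j) (Ioo_subset_Icc_self hx2)
    · refine ((hz g g' hg hu hf j).symm.trans (hB j)).trans (Finset.sum_congr rfl fun k _ => ?_)
      change _ = B j k * Real.exp (-(l * (ch k).τ)) * _
      linear_combination (-B j k * g k (a k)) * hexp k

end Network

theorem tendsto_rescaled_iff {E : Type*} [NormedAddCommGroup E] [NormedSpace ℝ E] (S : ℝ → E)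
    (l : ℝ) (u f : E) :
    Tendsto (fun t : ℝ => t⁻¹ • (S t - u)) (nhdsWithin 0 (Ioi 0)) (nhds (f - l • u)) ↔
      Tendsto (fun t : ℝ => t⁻¹ • (Real.exp (l * t) • S t - u)) (nhdsWithin 0 (Ioi 0))
        (nhds f) := by
  have hexp (s : ℝ) : Tendsto (fun t : ℝ => Real.exp (s * t)) (nhdsWithin 0 (Ioi 0)) (nhds 1) := by
    have h : Continuous fun t : ℝ => Real.exp (s * t) := by fun_prop
    simpa using (h.tendsto 0).mono_left nhdsWithin_le_nhds
  have hquot : Tendsto (fun t : ℝ => t⁻¹ * (Real.exp (l * t) - 1)) (nhdsWithin 0 (Ioi 0))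
      (nhds l) := by
    have h : HasDerivAt (fun t : ℝ => Real.exp (l * t)) l 0 := by
      simpa using ((hasDerivAt_id (0 : ℝ)).const_mul l).exp
    simpa using h.tendsto_slope_zero_right
  constructor
  · intro h
    have h1 := ((hexp l).smul h).add (hquot.smul_const u)
    rw [one_smul, sub_add_cancel] at h1
    refine h1.congr fun t => ?_
    module
  · intro h
    have h1 := (hexp (-l)).smul (h.sub (hquot.smul_const u))
    rw [one_smul] at h1
    refine h1.congr fun t => ?_
    have h2 : Real.exp (-l * t) * Real.exp (l * t) = 1 := by
      rw [← Real.exp_add, neg_mul, neg_add_cancel, Real.exp_zero]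
    have h3 : t⁻¹ • (Real.exp (l * t) • S t - u) - (t⁻¹ * (Real.exp (l * t) - 1)) • u =
        Real.exp (l * t) • (t⁻¹ • (S t - u)) := by
      module
    rw [h3, smul_smul, h2, one_smul]

theorem DelaySystem.exists_semigroup {J E : Type*} [Fintype J] [NormedAddCommGroup E]
    [NormedSpace ℝ E] [CompleteSpace E] (D : DelaySystem J E) (l : ℝ) :
    ∃ T : ℝ≥0 → (J → E) →L[ℝ] (J → E), T 0 = ContinuousLinearMap.id ℝ _ ∧
      (∀ s t : ℝ≥0, T (s + t) = (T s).comp (T t)) ∧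
      (∀ u, Continuous fun t : ℝ≥0 => T t u) ∧
      ∀ u f, D.Graph u (f - l • u) ↔ Tendsto (fun t : ℝ≥0 => (t : ℝ)⁻¹ • (T t u - u))
        (nhdsWithin 0 (Ioi 0)) (nhds f) := by
  refine ⟨fun t => Real.exp (l * t) • D.flow t, ?_, fun s t => ?_, fun u => ?_, fun u f => ?_⟩
  · ext1 u
    simp [D.flow_zero]
  · ext1 u
    change Real.exp (l * (s + t : ℝ≥0)) • D.flow (s + t : ℝ≥0) u =
      Real.exp (l * s) • D.flow s (Real.exp (l * t) • D.flow t u)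
    rw [map_smul, D.flow_flow s.coe_nonneg t.coe_nonneg, smul_smul, ← Real.exp_add, ← mul_add,
      NNReal.coe_add]
  · have h := D.continuous_flow u
    change Continuous fun t : ℝ≥0 => Real.exp (l * t) • D.flow t u
    have h2 : Continuous fun t : ℝ≥0 => D.flow t u := h.comp NNReal.continuous_coe
    have h3 : Continuous fun t : ℝ≥0 => Real.exp (l * t) := by fun_prop
    exact h3.smul h2
  · rw [D.graph_iff_tendsto, tendsto_rescaled_iff (fun t => D.flow t u),
      ← NNReal.coe_zero,
      ← NNReal.map_coe_nhdsGT, tendsto_map'_iff]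
    rfl

end HyperbolicNetwork

/-- **Generation theorem in `L¹` (Theorem 4.2).**
For disjoint finite index sets `J⁺, J⁻` with `|J⁺| + |J⁻| = 2m`, continuous strictly
positive speeds `c_j` on `[0,1]` and an arbitrary real `2m × 2m` boundary matrix `B`, the
operator `(A_B, D_1(A_B))` generates a strongly continuous semigroup on
`X₁ = (L¹(0,1))^{2m}`: there is a family `(T_t)_{t ≥ 0}` of bounded operators with
`T_0 = I`, `T_{s+t} = T_s T_t`, `t ↦ T_t u` continuous for every `u`, whose generator
(the right derivative of the orbit at `t = 0`) is exactly `(A_B, D_1(A_B))`. -/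
theorem AB_generates_C0_semigroup_on_L1
    {Jp Jm : Type*} [Fintype Jp] [Fintype Jm] (m : ℕ)
    (hcard : Fintype.card Jp + Fintype.card Jm = 2 * m)
    (c : Jp ⊕ Jm → ℝ → ℝ)
    (hc_cont : ∀ j, ContinuousOn (c j) (Set.Icc 0 1))
    (hc_pos : ∀ j, ∀ x ∈ Set.Icc (0:ℝ) 1, 0 < c j x)
    (B : Matrix (Jp ⊕ Jm) (Jp ⊕ Jm) ℝ) :
    ∃ T : ℝ≥0 → ((Jp ⊕ Jm) → Lp ℝ 1 mu01) →L[ℝ] ((Jp ⊕ Jm) → Lp ℝ 1 mu01),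
      T 0 = ContinuousLinearMap.id ℝ _ ∧
      (∀ s t : ℝ≥0, T (s + t) = (T s).comp (T t)) ∧
      (∀ u, Continuous fun t : ℝ≥0 => T t u) ∧
      (∀ u Au, ABGraph c B u Au ↔
        Tendsto (fun t : ℝ≥0 => (t : ℝ)⁻¹ • (T t u - u))
          (nhdsWithin 0 (Set.Ioi 0)) (nhds Au)) := by
  let e : Jp ⊕ Jm → ℝ := Sum.elim (fun _ => -1) fun _ => 1
  let a : Jp ⊕ Jm → ℝ := Sum.elim (fun _ => 1) fun _ => 0
  let z : Jp ⊕ Jm → ℝ := Sum.elim (fun _ => 0) fun _ => 1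
  have hch : ∀ j, Nonempty (HyperbolicNetwork.TravelChart (c j) (e j) (a j) (z j)) := by
    rintro (j | j)
    · exact HyperbolicNetwork.nonempty_travelChart_forward (hc_cont _) (hc_pos _)
    · exact HyperbolicNetwork.nonempty_travelChart_backward (hc_cont _) (hc_pos _)
  let ch := fun j => (hch j).some
  obtain ⟨l, hl⟩ := HyperbolicNetwork.exists_decay_rate (fun j => (ch j).τ)
    (fun j => (ch j).τ_pos) B
  obtain ⟨T, h0, hadd, hcont, hgen⟩ :=
    (HyperbolicNetwork.networkDelaySystem ch B l hl).exists_semigroup l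
  refine ⟨T, h0, hadd, hcont, fun u Au => ?_⟩
  rw [← hgen, HyperbolicNetwork.graph_networkDelaySystem_iff]
  refine exists_congr fun g => exists_congr fun g' => and_congr_right' (and_congr_right' ?_)
  rw [← and_assoc]
  refine and_congr ?_ ?_
  · rw [Sum.forall]
    simp [e]
  · rw [funext_iff]
    refine forall_congr' fun j => ?_
    have h1 : Sum.elim (fun j : Jp => g (Sum.inl j) 0) (fun j : Jm => g (Sum.inr j) 1) j =
        g j (z j) := by
      cases j <;> rfl
    have h2 : Sum.elim (fun j : Jp => g (Sum.inl j) 1) (fun j : Jm => g (Sum.inr j) 0) =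
        fun k => g k (a k) := by
      ext k
      cases k <;> rfl
    rw [h1, h2]
    rfl
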